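/- arXiv:1512.01994 — 3 statements merged into one kernel-verified Lean document; each statement's English description precedes it below -/
import Mathlib

section
/- Let G be a finite simple graph and let Γ be a nonempty subfamily of Ω(G). Then 2α(G) ≤ |⋂Γ| + |⋃Γ|. -/
/-- `S` is an independent set in `G`: no two of its vertices are adjacent. -/
def IndepSet {V : Type*} (G : SimpleGraph V) (S : Set V) : Prop :=
  ∀ ⦃u⦄, u ∈ S → ∀ ⦃v⦄, v ∈ S → ¬G.Adj u v

/-- The independence number `α(G)`. -/
noncomputable def indNum {V : Type*} (G : SimpleGraph V) : ℕ :=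
  sSup {n : ℕ | ∃ S : Set V, IndepSet G S ∧ S.ncard = n}

/-- `Ω(G)`: the family of maximum independent sets of `G`. -/
def maxIndepFam {V : Type*} (G : SimpleGraph V) : Set (Set V) :=
  {S | IndepSet G S ∧ S.ncard = indNum G}

/-- `N(X)`: the neighborhood of a set of vertices. -/
def nbhd {V : Type*} (G : SimpleGraph V) (X : Set V) : Set V :=
  {v | ∃ x ∈ X, G.Adj v x}

/-- `N[X] = N(X) ∪ X`: the closed neighborhood of a set of vertices. -/
def closedNbhd {V : Type*} (G : SimpleGraph V) (X : Set V) : Set V :=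
  nbhd G X ∪ X

/-- The difference `d(X) = |X| - |N(X)|`. -/
noncomputable def diffd {V : Type*} (G : SimpleGraph V) (X : Set V) : ℤ :=
  (X.ncard : ℤ) - ((nbhd G X).ncard : ℤ)

/-- The critical difference `d(G) = max {d(X) : X ⊆ V(G)}`. -/
noncomputable def critDiff {V : Type*} (G : SimpleGraph V) : ℤ :=
  sSup {d : ℤ | ∃ X : Set V, diffd G X = d}

/-- `X` is a critical set if `d(X) = d(G)`. -/
def IsCritical {V : Type*} (G : SimpleGraph V) (X : Set V) : Prop :=
  diffd G X = critDiff G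

/-- `MaxCritIndep(G)`: the family of critical independent sets of maximum cardinality. -/
def maxCritIndepFam {V : Type*} (G : SimpleGraph V) : Set (Set V) :=
  {S | IndepSet G S ∧ IsCritical G S ∧
    ∀ T : Set V, IndepSet G T → IsCritical G T → T.ncard ≤ S.ncard}

/-- The critical independence number `α'(G)`. -/
noncomputable def critIndNum {V : Type*} (G : SimpleGraph V) : ℕ :=
  sSup {n : ℕ | ∃ S : Set V, IndepSet G S ∧ IsCritical G S ∧ S.ncard = n}

/-- `ker(G)`: the intersection of all critical independent sets. -/
def kerSet {V : Type*} (G : SimpleGraph V) : Set V :=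
  ⋂₀ {A : Set V | IndepSet G A ∧ IsCritical G A}

/-- `nucleus(G)`: the intersection of all maximum critical independent sets. -/
def nucleus {V : Type*} (G : SimpleGraph V) : Set V :=
  ⋂₀ maxCritIndepFam G

/-- `diadem(G)`: the union of all maximum critical independent sets. -/
def diadem {V : Type*} (G : SimpleGraph V) : Set V :=
  ⋃₀ maxCritIndepFam G

/-- `core(G)`: the intersection of all maximum independent sets. -/
def coreSet {V : Type*} (G : SimpleGraph V) : Set V :=
  ⋂₀ maxIndepFam G

/-- `corona(G)`: the union of all maximum independent sets. -/
def coronaSet {V : Type*} (G : SimpleGraph V) : Set V :=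
  ⋃₀ maxIndepFam G

/-- A matching in `G`: a set of pairwise non-incident edges of `G`. -/
def IsMatchingSet {V : Type*} (G : SimpleGraph V) (M : Set (Sym2 V)) : Prop :=
  M ⊆ G.edgeSet ∧ M.Pairwise fun e f => ∀ v, v ∈ e → v ∉ f

/-- The matching number `μ(G)`. -/
noncomputable def matchNum {V : Type*} (G : SimpleGraph V) : ℕ :=
  sSup {n : ℕ | ∃ M : Set (Sym2 V), IsMatchingSet G M ∧ M.ncard = n}

/-- `G` is a König-Egerváry graph if `α(G) + μ(G) = |V(G)|`. -/
def IsKonigEgervary {V : Type*} (G : SimpleGraph V) : Prop :=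
  indNum G + matchNum G = Nat.card V

/-- `Γ` is a König-Egerváry collection: a family of independent sets with
`|⋂Γ| + |⋃Γ| = 2α(G)`. -/
def IsKECollection {V : Type*} (G : SimpleGraph V) (Γ : Set (Set V)) : Prop :=
  (∀ S ∈ Γ, IndepSet G S) ∧ (⋂₀ Γ).ncard + (⋃₀ Γ).ncard = 2 * indNum G

theorem IndepSet.ncard_le_indNum {V : Type*} [Finite V] {G : SimpleGraph V} {S : Set V}
    (hS : IndepSet G S) : S.ncard ≤ indNum G := by
  refine le_csSup ⟨Nat.card V, ?_⟩ ⟨S, hS, rfl⟩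
  rintro _ ⟨T, -, rfl⟩
  exact Set.ncard_le_card T

/-- The core of a nonempty family of independent sets, together with the part of another
independent set covered by the family, is independent. -/
theorem IndepSet.sInter_union_inter_sUnion {V : Type*} {G : SimpleGraph V} {Γ : Set (Set V)}
    {S : Set V} (hS : IndepSet G S) (hne : Γ.Nonempty) (hΓ : ∀ T ∈ Γ, IndepSet G T) :
    IndepSet G (⋂₀ Γ ∪ S ∩ ⋃₀ Γ) := by
  rintro u (hu | ⟨huS, T, hT, huT⟩) v (hv | ⟨hvS, T', hT', hvT'⟩)
  · obtain ⟨T, hT⟩ := hne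
    exact hΓ T hT (hu T hT) (hv T hT)
  · exact hΓ T' hT' (hu T' hT') hvT'
  · exact hΓ T hT huT (hv T hT)
  · exact hS huS hvS

/-- Adding a maximum independent set to a nonempty family of independent sets does not decrease
the sum of the sizes of the intersection and the union. -/
theorem ncard_sInter_add_ncard_sUnion_le_insert {V : Type*} [Finite V] {G : SimpleGraph V}
    {Γ : Set (Set V)} {S : Set V} (hS : S ∈ maxIndepFam G) (hne : Γ.Nonempty)
    (hΓ : ∀ T ∈ Γ, IndepSet G T) :
    (⋂₀ Γ).ncard + (⋃₀ Γ).ncard ≤ (⋂₀ insert S Γ).ncard + (⋃₀ insert S Γ).ncard := by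
  have hle := (hS.1.sInter_union_inter_sUnion hne hΓ).ncard_le_indNum
  have hinter := Set.ncard_union_add_ncard_inter (⋂₀ Γ) (S ∩ ⋃₀ Γ)
  have hunion := Set.ncard_union_add_ncard_inter S (⋃₀ Γ)
  have hsub : ⋂₀ Γ ⊆ ⋃₀ Γ := by
    obtain ⟨T, hT⟩ := hne
    exact (Set.sInter_subset_of_mem hT).trans (Set.subset_sUnion_of_mem hT)
  have heq : ⋂₀ Γ ∩ (S ∩ ⋃₀ Γ) = S ∩ ⋂₀ Γ := by
    rw [Set.inter_left_comm, Set.inter_eq_left.mpr hsub]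
  rw [heq] at hinter
  have hcard := hS.2
  rw [Set.sInter_insert, Set.sUnion_insert]
  omega

/-- If `Γ` is a nonempty subfamily of `Ω(G)`, then
`2α(G) ≤ |⋂Γ| + |⋃Γ|`. -/
theorem stmt15 {V : Type*} [Fintype V] (G : SimpleGraph V)
    (Γ : Set (Set V)) (hne : Γ.Nonempty) (hΓ : Γ ⊆ maxIndepFam G) :
    2 * indNum G ≤ (⋂₀ Γ).ncard + (⋃₀ Γ).ncard := by
  induction Γ, Γ.toFinite using Set.Finite.induction_on with
  | empty => exact absurd hne Set.not_nonempty_empty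
  | @insert S Γ _ _ ih =>
    rw [Set.insert_subset_iff] at hΓ
    obtain rfl | hne' := Γ.eq_empty_or_nonempty
    · have hcard := hΓ.1.2
      simp only [insert_empty_eq, Set.sInter_singleton, Set.sUnion_singleton]
      omega
    · exact (ih hne' hΓ.2).trans
        (ncard_sInter_add_ncard_sUnion_le_insert hΓ.1 hne' fun T hT => (hΓ.2 hT).1)
end

section
/- Let G be a finite simple König-Egerváry graph and let Γ be a nonempty subfamily of Ω(G). Then |⋂Γ| + |⋃Γ| = 2α(G); in particular, |core(G)| + |corona(G)| = 2α(G). -/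
theorem exists_isMatchingSet_ncard_eq_matchNum {V : Type*} [Finite V] (G : SimpleGraph V) :
    ∃ M : Set (Sym2 V), IsMatchingSet G M ∧ M.ncard = matchNum G := by
  have hne : {n : ℕ | ∃ M : Set (Sym2 V), IsMatchingSet G M ∧ M.ncard = n}.Nonempty :=
    ⟨0, ∅, ⟨Set.empty_subset _, Set.pairwise_empty _⟩, Set.ncard_empty _⟩
  refine Nat.sSup_mem hne ⟨(Set.univ : Set (Sym2 V)).ncard, ?_⟩
  rintro n ⟨M, -, rfl⟩
  exact Set.ncard_le_ncard (Set.subset_univ M)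

theorem IsMatchingSet.eq_of_mem {V : Type*} {G : SimpleGraph V} {M : Set (Sym2 V)}
    (hM : IsMatchingSet G M) {e f : Sym2 V} (he : e ∈ M) (hf : f ∈ M) {v : V}
    (hve : v ∈ e) (hvf : v ∈ f) : e = f := by
  by_contra hne
  exact hM.2 he hf hne v hve hvf

/-- If a matching has as many edges as the complement of an independent set `S` has vertices,
then every vertex outside `S` is the only endpoint outside `S` of its matching edge. -/
theorem IsMatchingSet.exists_mem_of_notMem {V : Type*} [Finite V] {G : SimpleGraph V}
    {M : Set (Sym2 V)} (hM : IsMatchingSet G M) {S : Set V} (hS : IndepSet G S)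
    (hcard : Sᶜ.ncard = M.ncard) {v : V} (hv : v ∉ S) :
    ∃ e ∈ M, v ∈ e ∧ ∀ w ∈ e, w ∉ S → w = v := by
  have hex : ∀ e ∈ M, ∃ x ∈ e, x ∉ S := by
    intro e he
    induction e using Sym2.ind with
    | _ a b =>
      by_contra! h
      exact hS (h a (Sym2.mem_mk_left a b)) (h b (Sym2.mem_mk_right a b)) (hM.1 he)
  have : Nonempty V := ⟨v⟩
  choose! g hg hgS using hex
  have hinj : Set.InjOn g M := fun e he f hf hef =>
    hM.eq_of_mem he hf (hg e he) (hef ▸ hg f hf)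
  have himage : g '' M = Sᶜ := by
    refine Set.eq_of_subset_of_ncard_le (Set.image_subset_iff.2 hgS) ?_
    rw [hinj.ncard_image, hcard]
  obtain ⟨e, he, rfl⟩ : v ∈ g '' M := himage ▸ hv
  refine ⟨e, he, hg e he, fun w hw hwS => ?_⟩
  obtain ⟨f, hf, rfl⟩ : w ∈ g '' M := himage ▸ hwS
  rw [hM.eq_of_mem he hf hw (hg f hf)]

/-- The mate of a vertex under a matching; unmatched vertices are their own mates. -/
noncomputable def mate {V : Type*} (M : Set (Sym2 V)) (v : V) : V :=
  open scoped Classical in if h : ∃ w, s(v, w) ∈ M then h.choose else v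

theorem mk_mate_mem {V : Type*} {M : Set (Sym2 V)} {v : V} (h : ∃ w, s(v, w) ∈ M) :
    s(v, mate M v) ∈ M := by
  rw [mate, dif_pos h]
  exact h.choose_spec

theorem IsMatchingSet.mate_eq {V : Type*} {G : SimpleGraph V} {M : Set (Sym2 V)}
    (hM : IsMatchingSet G M) {v w : V} (h : s(v, w) ∈ M) : mate M v = w :=
  Sym2.congr_right.1 (hM.eq_of_mem (mk_mate_mem ⟨w, h⟩) h
    (Sym2.mem_mk_left _ _) (Sym2.mem_mk_left _ _))

theorem IsMatchingSet.mate_involutive {V : Type*} {G : SimpleGraph V} {M : Set (Sym2 V)}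
    (hM : IsMatchingSet G M) : Function.Involutive (mate M) := by
  intro v
  by_cases h : ∃ w, s(v, w) ∈ M
  · exact hM.mate_eq (Sym2.eq_swap ▸ mk_mate_mem h)
  · have hv : mate M v = v := dif_neg h
    rw [hv, hv]

theorem IsMatchingSet.mem_iff_mate_notMem {V : Type*} [Finite V] {G : SimpleGraph V}
    {M : Set (Sym2 V)} (hM : IsMatchingSet G M) {S : Set V} (hS : IndepSet G S)
    (hcard : Sᶜ.ncard = M.ncard) {v : V} (hv : ∃ w, s(v, w) ∈ M) :
    v ∈ S ↔ mate M v ∉ S := by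
  have hvM := mk_mate_mem hv
  refine ⟨fun h h' => hS h h' (hM.1 hvM), fun h => ?_⟩
  by_contra hvS
  obtain ⟨e, he, hve, huniq⟩ := hM.exists_mem_of_notMem hS hcard hvS
  obtain rfl := hM.eq_of_mem he hvM hve (Sym2.mem_mk_left _ _)
  exact G.ne_of_adj (hM.1 hvM) (huniq _ (Sym2.mem_mk_right _ _) h).symm

theorem IsMatchingSet.exists_mk_mem_of_notMem {V : Type*} [Finite V] {G : SimpleGraph V}
    {M : Set (Sym2 V)} (hM : IsMatchingSet G M) {S : Set V} (hS : IndepSet G S)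
    (hcard : Sᶜ.ncard = M.ncard) {v : V} (hv : v ∉ S) : ∃ w, s(v, w) ∈ M := by
  obtain ⟨e, he, ⟨w, rfl⟩, -⟩ := hM.exists_mem_of_notMem hS hcard hv
  exact ⟨w, he⟩

theorem IsKonigEgervary.ncard_compl_eq_matchNum {V : Type*} [Finite V] {G : SimpleGraph V}
    (hKE : IsKonigEgervary G) {S : Set V} (hS : S ∈ maxIndepFam G) :
    Sᶜ.ncard = matchNum G := by
  have h := Set.ncard_add_ncard_compl S
  rw [hS.2, ← hKE] at h
  exact Nat.add_left_cancel h

/-- For a maximum matching `M`, the sum `|⋂Γ| + |⋃Γ|` depends only on the number of vertices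
that `M` misses. -/
theorem IsKonigEgervary.ncard_sInter_add_ncard_sUnion {V : Type*} [Finite V]
    {G : SimpleGraph V} (hKE : IsKonigEgervary G) {M : Set (Sym2 V)} (hM : IsMatchingSet G M)
    (hcard : M.ncard = matchNum G) {Γ : Set (Set V)} (hne : Γ.Nonempty)
    (hΓ : Γ ⊆ maxIndepFam G) :
    (⋂₀ Γ).ncard + (⋃₀ Γ).ncard = {v | ¬∃ w, s(v, w) ∈ M}.ncard + Nat.card V := by
  have hcompl : ∀ S ∈ Γ, Sᶜ.ncard = M.ncard := fun S hS =>
    (hKE.ncard_compl_eq_matchNum (hΓ hS)).trans hcard.symm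
  have hsub : {v | ¬∃ w, s(v, w) ∈ M} ⊆ ⋂₀ Γ := by
    intro v hv S hS
    by_contra hvS
    exact hv (hM.exists_mk_mem_of_notMem (hΓ hS).1 (hcompl S hS) hvS)
  have himage : mate M '' (⋂₀ Γ \ {v | ¬∃ w, s(v, w) ∈ M}) = (⋃₀ Γ)ᶜ := by
    ext v
    constructor
    · rintro ⟨u, ⟨hu, huM⟩, rfl⟩ ⟨S, hS, huS⟩
      exact (hM.mem_iff_mate_notMem (hΓ hS).1 (hcompl S hS) (not_not.1 huM)).1 (hu S hS) huS
    · intro hv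
      have hvS : ∀ S ∈ Γ, v ∉ S := fun S hS h => hv ⟨S, hS, h⟩
      obtain ⟨T, hT⟩ := hne
      have hvM := hM.exists_mk_mem_of_notMem (hΓ hT).1 (hcompl T hT) (hvS T hT)
      refine ⟨mate M v, ⟨fun S hS => ?_, not_not.2 ⟨v, Sym2.eq_swap ▸ mk_mate_mem hvM⟩⟩,
        hM.mate_involutive v⟩
      by_contra h
      exact hvS S hS ((hM.mem_iff_mate_notMem (hΓ hS).1 (hcompl S hS) hvM).2 h)
  have h1 := Set.ncard_sdiff_add_ncard_of_subset hsub
  have h2 := Set.ncard_add_ncard_compl (⋃₀ Γ)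
  rw [← himage, Set.ncard_image_of_injective _ hM.mate_involutive.injective] at h2
  omega

theorem IsKonigEgervary.ncard_sInter_add_ncard_sUnion_eq_two_mul {V : Type*} [Finite V]
    {G : SimpleGraph V} (hKE : IsKonigEgervary G) {Γ : Set (Set V)} (hne : Γ.Nonempty)
    (hΓ : Γ ⊆ maxIndepFam G) : (⋂₀ Γ).ncard + (⋃₀ Γ).ncard = 2 * indNum G := by
  obtain ⟨M, hM, hcard⟩ := exists_isMatchingSet_ncard_eq_matchNum G
  obtain ⟨S, hS⟩ := hne
  have h := hKE.ncard_sInter_add_ncard_sUnion hM hcard (Set.singleton_nonempty S)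
    (Set.singleton_subset_iff.2 (hΓ hS))
  rw [Set.sInter_singleton, Set.sUnion_singleton, (hΓ hS).2] at h
  rw [hKE.ncard_sInter_add_ncard_sUnion hM hcard ⟨S, hS⟩ hΓ, ← h, two_mul]

/-- If `G` is a König-Egerváry graph and `Γ` is a nonempty subfamily of
`Ω(G)`, then `|⋂Γ| + |⋃Γ| = 2α(G)`; in particular,
`|core(G)| + |corona(G)| = 2α(G)`. -/
theorem stmt16 {V : Type*} [Fintype V] (G : SimpleGraph V) (hKE : IsKonigEgervary G)
    (Γ : Set (Set V)) (hne : Γ.Nonempty) (hΓ : Γ ⊆ maxIndepFam G) :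
    (⋂₀ Γ).ncard + (⋃₀ Γ).ncard = 2 * indNum G ∧
    (coreSet G).ncard + (coronaSet G).ncard = 2 * indNum G := by
  exact ⟨hKE.ncard_sInter_add_ncard_sUnion_eq_two_mul hne hΓ,
    hKE.ncard_sInter_add_ncard_sUnion_eq_two_mul (hne.mono hΓ) subset_rfl⟩
end

section
/- Let G be a finite simple graph whose family MaxCritIndep(G) is nonempty. Then there exists X ⊆ V(G) such that X = N[S] for every S ∈ MaxCritIndep(G) (i.e., all maximum critical independent sets have the same closed neighborhood), and the induced subgraph G[X] is a König-Egerváry graph. -/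
section KonigEgervary

variable {V : Type*}

theorem IndepSet.disjoint_nbhd {G : SimpleGraph V} {S : Set V} (hS : IndepSet G S) :
    Disjoint S (nbhd G S) :=
  Set.disjoint_left.2 fun _ hv ⟨_, hx, hadj⟩ => hS hv hx hadj

theorem nbhd_subset_closedNbhd (G : SimpleGraph V) (S : Set V) : nbhd G S ⊆ closedNbhd G S :=
  Set.subset_union_left

theorem subset_closedNbhd (G : SimpleGraph V) (S : Set V) : S ⊆ closedNbhd G S :=
  Set.subset_union_right

theorem nbhd_union (G : SimpleGraph V) (A B : Set V) :
    nbhd G (A ∪ B) = nbhd G A ∪ nbhd G B := by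
  ext v
  simp only [nbhd, Set.mem_ofPred_eq, Set.mem_union, or_and_right, exists_or]

theorem nbhd_inter_subset (G : SimpleGraph V) (A B : Set V) :
    nbhd G (A ∩ B) ⊆ nbhd G A ∩ nbhd G B :=
  fun _ ⟨x, hx, h⟩ => ⟨⟨x, hx.1, h⟩, ⟨x, hx.2, h⟩⟩

variable [Finite V]

theorem diffd_le_critDiff (G : SimpleGraph V) (X : Set V) : diffd G X ≤ critDiff G :=
  le_csSup (Set.finite_range (diffd G)).bddAbove ⟨X, rfl⟩

theorem IsCritical.union {G : SimpleGraph V} {A B : Set V} (hA : IsCritical G A)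
    (hB : IsCritical G B) : IsCritical G (A ∪ B) := by
  have h1 := diffd_le_critDiff G (A ∪ B)
  have h2 := diffd_le_critDiff G (A ∩ B)
  have h3 := Set.ncard_union_add_ncard_inter A B
  have h4 := Set.ncard_union_add_ncard_inter (nbhd G A) (nbhd G B)
  have h5 := Set.ncard_le_ncard (nbhd_inter_subset G A B)
  unfold IsCritical at *
  simp only [diffd, nbhd_union] at *
  omega

/-- Hall's condition for matching the neighborhood of a critical set into that set. -/
theorem IsCritical.ncard_le_ncard_inter_nbhd {G : SimpleGraph V} {S A : Set V}
    (hS : IsCritical G S) (hA : A ⊆ nbhd G S) : A.ncard ≤ (S ∩ nbhd G A).ncard := by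
  have h1 := diffd_le_critDiff G (S \ nbhd G A)
  have h2 : nbhd G (S \ nbhd G A) ⊆ nbhd G S \ A :=
    fun v ⟨x, hx, h⟩ => ⟨⟨x, hx.1, h⟩, fun hv => hx.2 ⟨v, hv, h.symm⟩⟩
  have h3 := Set.ncard_le_ncard h2
  have h4 := Set.ncard_sdiff_add_ncard_of_subset hA
  have h5 := Set.ncard_inter_add_ncard_sdiff_eq_ncard S (nbhd G A)
  unfold IsCritical at hS
  simp only [diffd] at *
  omega

theorem IsCritical.exists_injective_matching {G : SimpleGraph V} {S : Set V}
    (hS : IsCritical G S) :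
    ∃ f : nbhd G S → V, Function.Injective f ∧ ∀ v, f v ∈ S ∧ G.Adj v (f v) := by
  classical
  have := Fintype.ofFinite V
  let t : nbhd G S → Finset V := fun v => {u | u ∈ S ∧ G.Adj v u}
  obtain ⟨f, hf, hft⟩ := (Finset.all_card_le_biUnion_card_iff_exists_injective t).1 fun A => by
    have h := hS.ncard_le_ncard_inter_nbhd (A := Subtype.val '' (A : Set (nbhd G S)))
      (by rintro _ ⟨v, -, rfl⟩; exact v.2)
    rw [Set.ncard_image_of_injective _ Subtype.val_injective, Set.ncard_coe_finset] at h
    refine h.trans ?_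
    rw [← Set.ncard_coe_finset]
    refine Set.ncard_le_ncard ?_
    rintro u ⟨hu, _, ⟨v, hv, rfl⟩, hadj⟩
    simp only [t, Finset.coe_biUnion, Set.mem_iUnion]
    exact ⟨v, hv, by simpa using ⟨hu, hadj.symm⟩⟩
  exact ⟨f, hf, fun v => by simpa [t] using hft v⟩

theorem IndepSet.ncard_add_ncard_le {G : SimpleGraph V} {S : Set V} {M : Set (Sym2 V)}
    (hS : IndepSet G S) (hM : IsMatchingSet G M) : S.ncard + M.ncard ≤ Nat.card V := by
  have key : ∀ e : M, ∃ v : (Sᶜ : Set V), v.1 ∈ e.1 := by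
    rintro ⟨e, he⟩
    induction e with
    | h x y =>
      by_cases hx : x ∈ S
      · exact ⟨⟨y, fun hy => hS hx hy (hM.1 he)⟩, Sym2.mem_mk_right x y⟩
      · exact ⟨⟨x, hx⟩, Sym2.mem_mk_left x y⟩
  choose f hf using key
  have hinj : Function.Injective f := fun e e' h => by
    by_contra hne
    exact hM.2 e.2 e'.2 (Subtype.coe_ne_coe.2 hne) _ (hf e) (h ▸ hf e')
  have h := Nat.card_le_card_of_injective f hinj
  rw [Nat.card_coe_set_eq, Nat.card_coe_set_eq] at h
  have := Set.ncard_add_ncard_compl S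
  omega

theorem isKonigEgervary_of_matching {G : SimpleGraph V} {S : Set V} {M : Set (Sym2 V)}
    (hS : IndepSet G S) (hM : IsMatchingSet G M) (h : Nat.card V ≤ S.ncard + M.ncard) :
    IsKonigEgervary G := by
  have hα : IsGreatest {n : ℕ | ∃ S : Set V, IndepSet G S ∧ S.ncard = n} S.ncard := by
    refine ⟨⟨S, hS, rfl⟩, ?_⟩
    rintro _ ⟨T, hT, rfl⟩
    have := hT.ncard_add_ncard_le hM
    omega
  have hμ : IsGreatest {n : ℕ | ∃ M : Set (Sym2 V), IsMatchingSet G M ∧ M.ncard = n}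
      M.ncard := by
    refine ⟨⟨M, hM, rfl⟩, ?_⟩
    rintro _ ⟨N, hN, rfl⟩
    have := hS.ncard_add_ncard_le hN
    omega
  have := hS.ncard_add_ncard_le hM
  unfold IsKonigEgervary indNum matchNum
  rw [hα.csSup_eq, hμ.csSup_eq]
  omega

theorem IsCritical.isKonigEgervary_induce_closedNbhd {G : SimpleGraph V} {S : Set V}
    (hc : IsCritical G S) (hS : IndepSet G S) :
    IsKonigEgervary (G.induce (closedNbhd G S)) := by
  obtain ⟨f, hf, hfS⟩ := hc.exists_injective_matching
  have hd := Set.disjoint_left.1 hS.disjoint_nbhd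
  let e : nbhd G S → Sym2 (closedNbhd G S) := fun v =>
    s(⟨v, nbhd_subset_closedNbhd G S v.2⟩, ⟨f v, subset_closedNbhd G S (hfS v).1⟩)
  have he : ∀ v w x, x ∈ e v → x ∈ e w → v = w := by
    intro v w x hv hw
    simp only [e, Sym2.mem_iff] at hv hw
    rcases hv with rfl | rfl <;> rcases hw with h | h <;> replace h := congrArg Subtype.val h
    · exact Subtype.ext h
    · exact absurd v.2 (hd (h ▸ (hfS w).1))
    · exact absurd w.2 (hd (h ▸ (hfS v).1))
    · exact hf h
  have hinj : Function.Injective e := fun v w h =>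
    he v w _ (Sym2.mem_mk_left _ _) (h ▸ Sym2.mem_mk_left _ _)
  refine isKonigEgervary_of_matching (S := Subtype.val ⁻¹' S) (M := Set.range e)
    (fun u hu v hv h => hS hu hv h) ⟨?_, ?_⟩ ?_
  · rintro _ ⟨v, rfl⟩
    exact (hfS v).2
  · rintro _ ⟨v, rfl⟩ _ ⟨w, rfl⟩ hvw x hv hw
    exact hvw (congrArg e (he v w x hv hw))
  · rw [← Set.image_univ, Set.ncard_image_of_injective _ hinj, Set.ncard_univ,
      Nat.card_coe_set_eq, Nat.card_coe_set_eq,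
      Set.ncard_preimage_of_injective_subset_range Subtype.val_injective
        (by rw [Subtype.range_coe]; exact subset_closedNbhd G S), add_comm]
    exact Set.ncard_union_le _ _

/-- A critical independent set stays critical when enlarged by the vertices of another critical set
that lie outside its neighborhood. -/
theorem IsCritical.union_sdiff_nbhd {G : SimpleGraph V} {S T : Set V} (hS : IndepSet G S)
    (hcS : IsCritical G S) (hcT : IsCritical G T) :
    IsCritical G (S ∪ T \ nbhd G S) := by
  have hcU : IsCritical G (S ∪ T) := hcS.union hcT
  have h1 := diffd_le_critDiff G (S ∪ T \ nbhd G S)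
  have h2 : (T ∩ nbhd G S).ncard ≤ (S ∩ nbhd G T).ncard :=
    (hcS.ncard_le_ncard_inter_nbhd Set.inter_subset_right).trans <| Set.ncard_le_ncard
      fun v ⟨hv, x, hx, h⟩ => ⟨hv, x, hx.1, h⟩
  have h3 : nbhd G (S ∪ T \ nbhd G S) ⊆ nbhd G (S ∪ T) \ (S ∩ nbhd G T) := by
    rintro v ⟨x, hx | hx, h⟩
    · exact ⟨⟨x, Or.inl hx, h⟩, fun hv => hS hv.1 hx h⟩
    · exact ⟨⟨x, Or.inr hx.1, h⟩, fun hv => hx.2 ⟨v, hv.1, h.symm⟩⟩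
  have h4 := Set.ncard_le_ncard h3
  have h5 : S ∩ nbhd G T ⊆ nbhd G (S ∪ T) := by
    rw [nbhd_union]
    exact Set.inter_subset_right.trans Set.subset_union_right
  have h6 := Set.ncard_sdiff_add_ncard_of_subset h5
  have h7 : (S ∪ T).ncard ≤ (S ∪ T \ nbhd G S).ncard + (T ∩ nbhd G S).ncard := by
    refine (Set.ncard_le_ncard fun v hv => ?_).trans (Set.ncard_union_le _ _)
    by_cases v ∈ nbhd G S <;> simp_all
  unfold IsCritical at *
  simp only [diffd] at *
  omega

theorem subset_closedNbhd_of_mem_maxCritIndepFam {G : SimpleGraph V} {S T : Set V}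
    (hS : S ∈ maxCritIndepFam G) (hT : T ∈ maxCritIndepFam G) : T ⊆ closedNbhd G S := by
  have hind : IndepSet G (S ∪ T \ nbhd G S) := by
    rintro u (hu | hu) v (hv | hv) h
    · exact hS.1 hu hv h
    · exact hv.2 ⟨u, hu, h.symm⟩
    · exact hu.2 ⟨v, hv, h⟩
    · exact hT.1 hu.1 hv.1 h
  have hle := hS.2.2 _ hind (IsCritical.union_sdiff_nbhd hS.1 hS.2.1 hT.2.1)
  have heq := Set.eq_of_subset_of_ncard_le (Set.subset_union_left (t := T \ nbhd G S)) hle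
  intro v hv
  by_cases hvN : v ∈ nbhd G S
  · exact Or.inl hvN
  · exact Or.inr (heq ▸ Or.inr ⟨hv, hvN⟩)

theorem closedNbhd_subset_of_mem_maxCritIndepFam {G : SimpleGraph V} {S T : Set V}
    (hS : S ∈ maxCritIndepFam G) (hT : T ∈ maxCritIndepFam G) :
    closedNbhd G T ⊆ closedNbhd G S := by
  have hTS := subset_closedNbhd_of_mem_maxCritIndepFam hS hT
  have hcU : IsCritical G (S ∪ T) := hS.2.1.union hT.2.1
  have hcS : IsCritical G S := hS.2.1
  have h1 : (T ∩ nbhd G S).ncard ≤ (S ∩ nbhd G T).ncard :=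
    (hcS.ncard_le_ncard_inter_nbhd Set.inter_subset_right).trans <| Set.ncard_le_ncard
      fun v ⟨hv, x, hx, h⟩ => ⟨hv, x, hx.1, h⟩
  have h2 : (S ∪ T).ncard ≤ S.ncard + (T ∩ nbhd G S).ncard := by
    refine (Set.ncard_le_ncard fun v hv => ?_).trans (Set.ncard_union_le _ _)
    rcases hv with hv | hv
    · exact Or.inl hv
    · exact (hTS hv).elim (fun h => Or.inr ⟨hv, h⟩) Or.inl
  have h3 : (nbhd G S ∪ S ∩ nbhd G T).ncard = (nbhd G S).ncard + (S ∩ nbhd G T).ncard :=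
    Set.ncard_union_eq (hS.1.disjoint_nbhd.symm.mono_right Set.inter_subset_left)
  have h4 : nbhd G S ∪ S ∩ nbhd G T ⊆ nbhd G (S ∪ T) := by
    rw [nbhd_union]
    exact Set.union_subset_union_right _ Set.inter_subset_right
  have heq := Set.eq_of_subset_of_ncard_le h4 (by
    unfold IsCritical at *
    simp only [diffd] at *
    omega)
  refine Set.union_subset (fun v hv => ?_) hTS
  have hvU : v ∈ nbhd G (S ∪ T) := by rw [nbhd_union]; exact Or.inr hv
  rw [← heq] at hvU
  exact hvU.imp id And.left

end KonigEgervary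

/-- If `MaxCritIndep(G)` is nonempty, then there is `X ⊆ V(G)` with
`X = N[S]` for every `S ∈ MaxCritIndep(G)`, and `G[X]` is a König-Egerváry graph. -/
theorem stmt17 {V : Type*} [Fintype V] (G : SimpleGraph V)
    (hne : (maxCritIndepFam G).Nonempty) :
    ∃ X : Set V, (∀ S ∈ maxCritIndepFam G, X = closedNbhd G S) ∧
      IsKonigEgervary (G.induce X) := by
  obtain ⟨S, hS⟩ := hne
  exact ⟨closedNbhd G S, fun T hT => (closedNbhd_subset_of_mem_maxCritIndepFam hT hS).antisymm
    (closedNbhd_subset_of_mem_maxCritIndepFam hS hT), hS.2.1.isKonigEgervary_induce_closedNbhd hS.1⟩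
end
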